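/- arXiv:1609.09684 — 5 statements merged into one kernel-verified Lean document; each statement's English description precedes it below -/
import Mathlib

section
/- For every integer n ≥ 3, the cycle C_n on n vertices satisfies FTD(C_n) = n/γ_t(C_n), where γ_t(C_n) = ⌊n/2⌋ + ⌈n/4⌉ − ⌊n/4⌋ is the total domination number of the cycle. -/
/-- The number of members of the family `F` (counted with multiplicity) containing `v`. -/
def appearCount {V : Type*} [DecidableEq V] (F : Multiset (Finset V)) (v : V) : ℕ :=
  Multiset.countP (fun S => v ∈ S) F

/-- `r_F`: the maximum, over all vertices `v`, of the number of members of `F` containing `v`. -/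
def maxAppear {V : Type*} [Fintype V] [DecidableEq V] (F : Multiset (Finset V)) : ℕ :=
  Finset.univ.sup fun v : V => appearCount F v

/-- `S` is a total dominating set of `G`: every vertex of `G` has a neighbor in `S`. -/
def IsTotalDomSet {V : Type*} (G : SimpleGraph V) (S : Finset V) : Prop :=
  ∀ v : V, ∃ u ∈ S, G.Adj v u

/-- The fractional total domatic number `FTD(G)`: the supremum of the effective ratio
`|F| / r_F` over all nonempty thoroughly distributed families `F` of `G`, i.e. finite
families (with repetition allowed) of total dominating sets of `G`. -/
noncomputable def FTD {V : Type*} [Fintype V] [DecidableEq V] (G : SimpleGraph V) : ℝ :=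
  sSup { r : ℝ | ∃ F : Multiset (Finset V), F ≠ 0 ∧ (∀ S ∈ F, IsTotalDomSet G S) ∧
      r = (Multiset.card F : ℝ) / (maxAppear F : ℝ) }

/-- The total domination number: the minimum size of a total dominating set. -/
noncomputable def gammaT {V : Type*} [Fintype V] [DecidableEq V] (G : SimpleGraph V) : ℕ :=
  sInf { k : ℕ | ∃ S : Finset V, IsTotalDomSet G S ∧ S.card = k }

theorem aux_tds_iff (m : ℕ) (S : Finset (Fin (m + 2))) :
    IsTotalDomSet (SimpleGraph.cycleGraph (m + 2)) S ↔ ∀ v : Fin (m + 2), v + 1 ∈ S ∨ v - 1 ∈ S := by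
  unfold IsTotalDomSet
  refine forall_congr' fun v => ?_
  constructor
  · rintro ⟨u, hu, h⟩
    rw [SimpleGraph.cycleGraph_adj] at h
    rcases h with h | h
    · right
      have : v - 1 = u := by rw [← h]; abel
      rwa [this]
    · left
      have : v + 1 = u := by rw [← h]; abel
      rwa [this]
  · rintro (h | h)
    · exact ⟨_, h, by rw [SimpleGraph.cycleGraph_adj]; right; abel⟩
    · exact ⟨_, h, by rw [SimpleGraph.cycleGraph_adj]; left; abel⟩

theorem aux_card (n : ℕ) :
    ((Finset.range n).filter (fun i => i % 4 < 2)).card = n / 2 + (n + 3) / 4 - n / 4 := by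
  induction n with
  | zero => rfl
  | succ k ih =>
    rw [Finset.range_add_one, Finset.filter_insert]
    split_ifs with h
    · rw [Finset.card_insert_of_notMem (by simp), ih]; omega
    · rw [ih]; omega

def auxS (n : ℕ) : Finset (Fin n) := Finset.univ.filter (fun i : Fin n => i.val % 4 < 2)

theorem auxS_card (n : ℕ) : (auxS n).card = n / 2 + (n + 3) / 4 - n / 4 := by
  rw [← aux_card, auxS, ← Finset.card_map Fin.valEmbedding]
  congr 1
  ext i
  simp only [Finset.mem_map, Finset.mem_filter, Finset.mem_univ, true_and, Finset.mem_range,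
    Fin.valEmbedding_apply]
  constructor
  · rintro ⟨a, h, rfl⟩; exact ⟨a.2, h⟩
  · rintro ⟨h, h'⟩; exact ⟨⟨i, h⟩, h', rfl⟩

theorem auxS_tds (m : ℕ) (hm : 1 ≤ m) :
    IsTotalDomSet (SimpleGraph.cycleGraph (m + 2)) (auxS (m + 2)) := by
  rw [aux_tds_iff]
  intro v
  simp only [auxS, Finset.mem_filter, Finset.mem_univ, true_and]
  by_cases hl : v.val = m + 1
  · left
    have : v + 1 = 0 := by
      have : v = Fin.last (m + 1) := Fin.ext hl
      rw [this]; simp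
    rw [this]; simp
  · have h1 : (v + 1).val = v.val + 1 := by
      apply Fin.val_add_one_of_lt
      rw [Fin.lt_def]; simp; have := v.2; omega
    rw [h1]
    by_cases h0 : v.val = 0
    · left; omega
    · have h2 : (v - 1).val = v.val - 1 := by
        rw [Fin.val_sub_one_of_ne_zero]
        intro h; apply h0; rw [h]; rfl
      rw [h2]
      omega

theorem aux_lower (m : ℕ) (S : Finset (Fin (m + 2)))
    (h : ∀ v : Fin (m + 2), v + 1 ∈ S ∨ v - 1 ∈ S) :
    (m + 2) / 2 + (m + 2 + 3) / 4 - (m + 2) / 4 ≤ S.card := by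
  have s1 : ∑ v : Fin (m + 2), (if v + 1 ∈ S then 1 else 0) = S.card := by
    refine (Equiv.sum_comp (Equiv.addRight (1 : Fin (m + 2))) (fun v => if v ∈ S then 1 else 0)).trans ?_
    simp
  have s2 : ∑ v : Fin (m + 2), (if v - 1 ∈ S then 1 else 0) = S.card := by
    refine (Equiv.sum_comp (Equiv.subRight (1 : Fin (m + 2))) (fun v => if v ∈ S then 1 else 0)).trans ?_
    simp
  have hle : ∀ v ∈ (Finset.univ : Finset (Fin (m + 2))),
      1 ≤ (if v + 1 ∈ S then 1 else 0) + (if v - 1 ∈ S then 1 else 0) := by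
    intro v _
    rcases h v with h | h <;> simp [h]
  have hs : ∑ v : Fin (m + 2), ((if v + 1 ∈ S then 1 else 0) + (if v - 1 ∈ S then 1 else 0))
      = S.card + S.card := by
    rw [Finset.sum_add_distrib, s1, s2]
  have h1 : m + 2 ≤ S.card + S.card := by
    have := Finset.sum_le_sum hle
    rw [hs] at this
    simpa using this
  by_contra hc
  have hmod : (m + 2) % 4 = 2 := by omega
  have heq : S.card + S.card = m + 2 := by omega
  have hall : ∀ v : Fin (m + 2),
      1 = (if v + 1 ∈ S then 1 else 0) + (if v - 1 ∈ S then 1 else 0) := by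
    have := (Finset.sum_eq_sum_iff_of_le hle).1 (by rw [hs, heq]; simp)
    intro v
    exact this v (Finset.mem_univ _)
  have hstep : ∀ x : Fin (m + 2), x + (1 + 1) ∈ S ↔ x ∉ S := by
    intro x
    have := hall (x + 1)
    rw [add_assoc x 1 1, add_sub_cancel_right] at this
    by_cases a : x + (1 + 1) ∈ S <;> by_cases b : x ∈ S <;> simp [a, b] at this ⊢
  have hit : ∀ k : ℕ, (k • (1 + 1 : Fin (m + 2)) ∈ S ↔ (k % 2 = 0 ↔ (0 : Fin (m + 2)) ∈ S)) := by
    intro k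
    induction k with
    | zero => simp
    | succ k ih =>
      rw [succ_nsmul, hstep, ih]
      have : (k + 1) % 2 = 0 ↔ ¬ k % 2 = 0 := by omega
      rw [this]; tauto
  have := hit S.card
  have e : S.card • (1 + 1 : Fin (m + 2)) = 0 := by
    have h0 := card_nsmul_eq_zero (x := (1 : Fin (m + 2)))
    rw [nsmul_add, ← add_nsmul, heq]
    simpa only [Fintype.card_fin] using h0
  rw [e] at this
  have : ¬ S.card % 2 = 0 := by omega
  tauto

theorem aux_gamma (m : ℕ) (hm : 1 ≤ m) :
    gammaT (SimpleGraph.cycleGraph (m + 2)) = (m + 2) / 2 + (m + 2 + 3) / 4 - (m + 2) / 4 := by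
  have hl : IsLeast { k : ℕ | ∃ S : Finset (Fin (m + 2)),
      IsTotalDomSet (SimpleGraph.cycleGraph (m + 2)) S ∧ S.card = k }
      ((m + 2) / 2 + (m + 2 + 3) / 4 - (m + 2) / 4) := by
    refine ⟨⟨_, auxS_tds m hm, auxS_card _⟩, ?_⟩
    rintro k ⟨S, hS, rfl⟩
    exact aux_lower m S ((aux_tds_iff m S).1 hS)
  exact hl.csInf_eq

theorem aux_double {V : Type*} [Fintype V] [DecidableEq V] (F : Multiset (Finset V)) :
    ∑ v : V, appearCount F v = (F.map Finset.card).sum := by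
  induction F using Multiset.induction_on with
  | empty => simp [appearCount]
  | cons S F ih =>
    rw [Multiset.map_cons, Multiset.sum_cons, ← ih]
    simp only [appearCount, Multiset.countP_cons, Finset.sum_add_distrib]
    rw [add_comm]; simp

theorem aux_upper {V : Type*} [Fintype V] [DecidableEq V] (F : Multiset (Finset V)) (g : ℕ)
    (h : ∀ S ∈ F, g ≤ S.card) : Multiset.card F * g ≤ Fintype.card V * maxAppear F := by
  calc Multiset.card F * g = Multiset.card (F.map Finset.card) • g := by simp
    _ ≤ (F.map Finset.card).sum := by
      apply Multiset.card_nsmul_le_sum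
      intro x hx
      obtain ⟨S, hS, rfl⟩ := Multiset.mem_map.1 hx
      exact h S hS
    _ = ∑ v : V, appearCount F v := (aux_double F).symm
    _ ≤ ∑ v : V, maxAppear F := Finset.sum_le_sum fun v _ =>
      Finset.le_sup (f := fun v : V => appearCount F v) (Finset.mem_univ v)
    _ = _ := by simp

def auxF (m : ℕ) : Multiset (Finset (Fin (m + 2))) :=
  (Finset.univ : Finset (Fin (m + 2))).val.map
    fun t => Finset.univ.filter (fun x => x - t ∈ auxS (m + 2))

theorem auxF_appear (m : ℕ) (v : Fin (m + 2)) :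
    appearCount (auxF m) v = (auxS (m + 2)).card := by
  rw [appearCount, auxF, Multiset.countP_map, ← Finset.filter_val, Finset.card_val]
  simp only [Finset.mem_filter, Finset.mem_univ, true_and]
  refine Finset.card_bij (fun t _ => v - t) ?_ ?_ ?_
  · intro a ha; simpa using ha
  · intro a _ b _ h; simpa using h
  · intro b hb; exact ⟨v - b, by simpa using hb, by simp⟩

theorem stmt1 (n : ℕ) (hn : 3 ≤ n) :
    gammaT (SimpleGraph.cycleGraph n) = n / 2 + (n + 3) / 4 - n / 4 ∧
    FTD (SimpleGraph.cycleGraph n) =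
      (n : ℝ) / (gammaT (SimpleGraph.cycleGraph n) : ℝ) := by
  obtain ⟨m, rfl⟩ : ∃ m, n = m + 2 := ⟨n - 2, by omega⟩
  have hm : 1 ≤ m := by omega
  refine ⟨aux_gamma m hm, ?_⟩
  rw [aux_gamma m hm]
  have hg : 0 < (m + 2) / 2 + (m + 2 + 3) / 4 - (m + 2) / 4 := by omega
  have hS := auxS_card (m + 2)
  generalize hgd : (m + 2) / 2 + (m + 2 + 3) / 4 - (m + 2) / 4 = g at hg hS
  have hl : IsGreatest { r : ℝ | ∃ F : Multiset (Finset (Fin (m + 2))), F ≠ 0 ∧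
      (∀ S ∈ F, IsTotalDomSet (SimpleGraph.cycleGraph (m + 2)) S) ∧
      r = (Multiset.card F : ℝ) / (maxAppear F : ℝ) } (((m + 2 : ℕ) : ℝ) / (g : ℝ)) := by
    constructor
    · have hc : Multiset.card (auxF m) = m + 2 := by simp [auxF]
      refine ⟨auxF m, ?_, ?_, ?_⟩
      · intro h0; rw [h0] at hc; simp at hc
      · intro S hSm
        obtain ⟨t, -, rfl⟩ := Multiset.mem_map.1 hSm
        rw [aux_tds_iff]
        intro v
        have := (aux_tds_iff m _).1 (auxS_tds m hm) (v - t)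
        simp only [Finset.mem_filter, Finset.mem_univ, true_and]
        have e1 : v + 1 - t = v - t + 1 := by abel
        have e2 : v - 1 - t = v - t - 1 := by abel
        rwa [e1, e2]
      · have : maxAppear (auxF m) = g := by
          unfold maxAppear
          simp only [auxF_appear, hS]
          exact Finset.sup_const Finset.univ_nonempty _
        rw [hc, this]
    · rintro r ⟨F, hF, hd, rfl⟩
      have hu := aux_upper F g (fun S hSm => by
        rw [← hgd]; exact aux_lower m S ((aux_tds_iff m S).1 (hd S hSm)))
      rw [Fintype.card_fin] at hu
      have hcp : 0 < Multiset.card F := Multiset.card_pos.2 hF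
      have hr : 0 < maxAppear F := by
        rcases Nat.eq_zero_or_pos (maxAppear F) with h0 | h0
        · rw [h0] at hu
          have := Nat.mul_pos hcp hg
          omega
        · exact h0
      rw [div_le_div_iff₀ (by exact_mod_cast hr) (by exact_mod_cast hg)]
      exact_mod_cast hu
  exact hl.csSup_eq
end

section
/- If a graph G of order n has minimum degree δ ≥ 1, then FTD(G) ≥ n/(n − δ + 1). -/
theorem card_le_sum_appear {V : Type*} [Fintype V] [DecidableEq V] (F : Multiset (Finset V))
    (hF : ∀ S ∈ F, S.Nonempty) : Multiset.card F ≤ ∑ v : V, appearCount F v := by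
  induction F using Multiset.induction_on with
  | empty => simp
  | cons S F ih =>
    have h1 := ih (fun T hT => hF T (Multiset.mem_cons_of_mem hT))
    obtain ⟨u, hu⟩ := hF S (Multiset.mem_cons_self S F)
    have h2 : ∑ v : V, appearCount (S ::ₘ F) v
        = ∑ v : V, appearCount F v + ∑ v : V, (if v ∈ S then 1 else 0) := by
      rw [← Finset.sum_add_distrib]
      refine Finset.sum_congr rfl fun v _ => ?_
      unfold appearCount
      rw [Multiset.countP_cons]
    have h3 : 1 ≤ ∑ v : V, (if v ∈ S then 1 else 0) := by
      have := Finset.card_pos.mpr ⟨u, hu⟩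
      simpa using this
    rw [h2, Multiset.card_cons]
    omega

theorem appear_powersetCard {V : Type*} [Fintype V] [DecidableEq V] (m k : ℕ)
    (hm : Fintype.card V = m + 1) (v : V) :
    appearCount (Finset.powersetCard (k + 1) (Finset.univ : Finset V)).val v = m.choose k := by
  unfold appearCount
  rw [Multiset.countP_eq_card_filter, ← Finset.filter_val, Finset.card_val]
  have h1 := Finset.card_filter_add_card_filter_not (s := Finset.powersetCard (k + 1) (Finset.univ : Finset V))
    (fun S => v ∈ S)
  have h2 : (Finset.powersetCard (k + 1) (Finset.univ : Finset V)).filter (fun S => ¬ v ∈ S)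
      = Finset.powersetCard (k + 1) (Finset.univ.erase v) := by
    ext S
    simp only [Finset.mem_filter, Finset.mem_powersetCard, Finset.subset_erase]
    tauto
  rw [h2, Finset.card_powersetCard, Finset.card_powersetCard, Finset.card_erase_of_mem (Finset.mem_univ v),
    Finset.card_univ, hm, Nat.choose_succ_succ] at h1
  simp only [Nat.add_sub_cancel] at h1
  simp only [Nat.succ_eq_add_one] at h1
  omega

theorem stmt3 {V : Type*} [Fintype V] [DecidableEq V] (G : SimpleGraph V)
    [DecidableRel G.Adj] (h : 1 ≤ G.minDegree) :
    (Fintype.card V : ℝ) / ((Fintype.card V : ℝ) - (G.minDegree : ℝ) + 1) ≤ FTD G := by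
  have hne : Nonempty V := by
    by_contra hc
    rw [not_nonempty_iff] at hc
    simp at h
  obtain ⟨v0⟩ := hne
  have hd : G.minDegree < Fintype.card V :=
    lt_of_le_of_lt (G.minDegree_le_degree v0) (G.degree_lt_card_verts v0)
  obtain ⟨m, hm⟩ : ∃ m, Fintype.card V = m + 1 := ⟨Fintype.card V - 1, by omega⟩
  obtain ⟨k, hk⟩ : ∃ k, k + G.minDegree = Fintype.card V := ⟨Fintype.card V - G.minDegree, by omega⟩
  have hkm : k ≤ m := by omega
  have hpos : 0 < m.choose k := Nat.choose_pos hkm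
  have hmax : maxAppear (Finset.powersetCard (k + 1) (Finset.univ : Finset V)).val = m.choose k := by
    unfold maxAppear
    rw [Finset.sup_congr rfl (fun v _ => appear_powersetCard m k hm v)]
    exact Finset.sup_const ⟨v0, Finset.mem_univ _⟩ _
  have hcard : Multiset.card (Finset.powersetCard (k + 1) (Finset.univ : Finset V)).val
      = (m + 1).choose (k + 1) := by
    rw [Finset.card_val, Finset.card_powersetCard, Finset.card_univ, hm]
  unfold FTD
  refine le_csSup ⟨(Fintype.card V : ℝ), ?_⟩ ⟨(Finset.powersetCard (k + 1) (Finset.univ : Finset V)).val, ?_, ?_, ?_⟩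
  · rintro r ⟨F, -, hF, rfl⟩
    have h1 := card_le_sum_appear F (fun S hS => by
      obtain ⟨u, hu, -⟩ := hF S hS v0
      exact ⟨u, hu⟩)
    have h2 : ∑ v : V, appearCount F v ≤ Fintype.card V * maxAppear F := by
      have := Finset.sum_le_card_nsmul (Finset.univ : Finset V) (fun v => appearCount F v) (maxAppear F)
        (fun v hv => Finset.le_sup (f := fun v : V => appearCount F v) hv)
      simpa using this
    refine div_le_of_le_mul₀ (by positivity) (by positivity) ?_
    exact_mod_cast h1.trans h2
  · intro h0
    rw [h0] at hcard
    have : 0 < (m + 1).choose (k + 1) := Nat.choose_pos (by omega)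
    simp at hcard
    omega
  · intro S hS v
    have hS' : S.card = k + 1 := (Finset.mem_powersetCard.mp (Finset.mem_val.mp hS)).2
    by_contra hc
    push Not at hc
    have hdisj : Disjoint S (G.neighborFinset v) := by
      rw [Finset.disjoint_left]
      intro u hu hu'
      exact hc u hu (by simpa using hu')
    have h1 := Finset.card_le_univ (S ∪ G.neighborFinset v)
    rw [Finset.card_union_of_disjoint hdisj, G.card_neighborFinset_eq_degree] at h1
    have h2 := G.minDegree_le_degree v
    omega
  · rw [hmax, hcard]
    have e : (Fintype.card V : ℝ) - (G.minDegree : ℝ) + 1 = (k : ℝ) + 1 := by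
      rw [← hk]; push_cast; ring
    rw [e, hm, div_eq_div_iff (by positivity) (by positivity)]
    exact_mod_cast Nat.add_one_mul_choose_eq m k
end

section
/- If H is a connected 3-regular 3-uniform hypergraph on n vertices, then FDT(H) ≥ 2n/(n + 1). -/
/-- `T` is a transversal of the hypergraph with edge family `E`: it meets every edge. -/
def IsTransversal {V : Type*} (E : Multiset (Finset V)) (T : Finset V) : Prop :=
  ∀ e ∈ E, ∃ v ∈ e, v ∈ T

/-- The fractional disjoint transversal number `FDT(H)`: the supremum of the effective ratio
`|F| / r_F` over all nonempty transversal families `F` of the hypergraph with edge family `E`. -/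
noncomputable def FDT {V : Type*} [Fintype V] [DecidableEq V] (E : Multiset (Finset V)) : ℝ :=
  sSup { r : ℝ | ∃ F : Multiset (Finset V), F ≠ 0 ∧ (∀ T ∈ F, IsTransversal E T) ∧
      r = (Multiset.card F : ℝ) / (maxAppear F : ℝ) }

theorem sum_countP_mem {V : Type*} [DecidableEq V] (W : Finset V) (M : Multiset (Finset V)) :
    ∑ v ∈ W, Multiset.countP (fun e => v ∈ e) M = (M.map fun e => (W ∩ e).card).sum := by
  induction M using Multiset.induction_on with
  | empty => simp
  | cons a M ih =>
    simp only [Multiset.countP_cons, Finset.sum_add_distrib, ih, Multiset.map_cons,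
      Multiset.sum_cons]
    rw [← Finset.filter_mem_eq_inter, Finset.card_filter]
    omega

/-- Seymour-type two-colouring lemma via linear algebra. -/
theorem two_color {V : Type*} [DecidableEq V] (S : Finset (Finset V)) (k : ℕ) :
    ∀ U : Finset V, U.card ≤ k →
    (∀ W ⊆ U, W.Nonempty → (S.filter (· ⊆ W)).card < W.card) →
    ∃ T : Finset V, ∀ e ∈ S, e ⊆ U → e.Nonempty → (∃ v ∈ e, v ∈ T) ∧ ∃ v ∈ e, v ∉ T := by
  induction k with
  | zero =>
    intro U hU _
    refine ⟨∅, fun e _ heU hne => ?_⟩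
    have : U = ∅ := by simpa using hU
    subst this
    obtain ⟨v, hv⟩ := hne
    simpa using heU hv
  | succ k ih =>
    intro U hU h
    by_cases hUe : U = ∅
    · subst hUe
      refine ⟨∅, fun e _ heU hne => ?_⟩
      obtain ⟨v, hv⟩ := hne
      simpa using heU hv
    have hlt := h U subset_rfl (Finset.nonempty_iff_ne_empty.2 hUe)
    let f : (U → ℝ) →ₗ[ℝ] ((S.filter (· ⊆ U) : Finset (Finset V)) → ℝ) :=
      LinearMap.pi fun e => ∑ v : U, if (v : V) ∈ (e : Finset V) then LinearMap.proj v else 0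
    have hker : LinearMap.ker f ≠ ⊥ := by
      apply LinearMap.ker_ne_bot_of_finrank_lt
      simpa using hlt
    obtain ⟨x, hx, hx0⟩ := (Submodule.ne_bot_iff _).1 hker
    let y : V → ℝ := fun v => if hv : v ∈ U then x ⟨v, hv⟩ else 0
    have hy : ∀ e ∈ S, e ⊆ U → ∑ v ∈ e, y v = 0 := by
      intro e he heU
      have h1 := congrFun (LinearMap.mem_ker.1 hx) ⟨e, by simp [he, heU]⟩
      have h2 : ∑ v : U, (if (v : V) ∈ e then x v else 0) = 0 := by
        refine Eq.trans ?_ h1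
        simp only [f, LinearMap.pi_apply, LinearMap.sum_apply]
        refine Finset.sum_congr rfl fun v _ => ?_
        split_ifs <;> simp
      rw [← h2]
      have h3 : ∑ v : U, (if (v : V) ∈ e then x v else 0)
          = ∑ v : U, (fun w => if w ∈ e then y w else 0) (v : V) := by
        refine Finset.sum_congr rfl fun v _ => ?_
        simp [y]
      rw [h3, Finset.sum_coe_sort U (fun w => if w ∈ e then y w else 0), Finset.sum_ite_mem,
        Finset.inter_eq_right.2 heU]
    obtain ⟨u, hu⟩ := Function.ne_iff.1 hx0
    have hyu : y u ≠ 0 := by simpa [y] using hu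
    have hZ : U.filter (fun v => y v = 0) ⊂ U := by
      refine Finset.filter_ssubset.2 ⟨u, u.2, hyu⟩
    obtain ⟨T, hT⟩ := ih (U.filter (fun v => y v = 0))
      (by have := Finset.card_lt_card hZ; omega)
      (fun W hW hne => h W (hW.trans hZ.subset) hne)
    refine ⟨U.filter (fun v => 0 < y v ∨ (y v = 0 ∧ v ∈ T)), fun e he heU hne => ?_⟩
    by_cases hz : ∀ v ∈ e, y v = 0
    · obtain ⟨⟨a, ha, haT⟩, b, hb, hbT⟩ := hT e he
        (fun v hv => Finset.mem_filter.2 ⟨heU hv, hz v hv⟩) hne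
      exact ⟨⟨a, ha, by simp [heU ha, hz a ha, haT]⟩, b, hb, by simp [hz b hb, hbT]⟩
    · push Not at hz
      obtain ⟨a, ha, hpos⟩ := Finset.exists_pos_of_sum_zero_of_exists_nonzero y (hy e he heU) hz
      obtain ⟨b, hb, hneg⟩ := Finset.exists_pos_of_sum_zero_of_exists_nonzero (s := e) (fun v => - y v)
        (by simp [hy e he heU]) (by simpa using hz)
      refine ⟨⟨a, ha, by simp [heU ha, hpos]⟩, b, hb, ?_⟩
      have hneg' : y b < 0 := by simpa using hneg
      simp only [Finset.mem_filter, not_and, not_or]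
      exact fun _ => ⟨not_lt.2 hneg'.le, fun h0 => absurd h0 hneg'.ne⟩

theorem edges_lt {V : Type*} [Fintype V] [DecidableEq V] (E : Multiset (Finset V))
    (h3u : ∀ e ∈ E, e.card = 3)
    (h3r : ∀ v : V, Multiset.countP (fun e => v ∈ e) E = 3)
    (hconn : (SimpleGraph.fromRel fun u v : V => ∃ e ∈ E, u ∈ e ∧ v ∈ e).Connected)
    (W : Finset V) (hne : W.Nonempty) (v : V) (hv : v ∉ W) :
    (E.toFinset.filter (· ⊆ W)).card < W.card := by
  -- an edge crossing the boundary of `W`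
  obtain ⟨e, he, ⟨a, hae, haW⟩, b, hbe, hbW⟩ :
      ∃ e ∈ E, (∃ a ∈ e, a ∈ W) ∧ ∃ b ∈ e, b ∉ W := by
    obtain ⟨w, hw⟩ := hne
    obtain ⟨p⟩ := hconn.preconnected w v
    obtain ⟨d, _, hd1, hd2⟩ := p.exists_boundary_dart (W : Set V) hw hv
    have hadj := d.adj
    rw [SimpleGraph.fromRel_adj] at hadj
    obtain ⟨_, ⟨e, he, h1, h2⟩ | ⟨e, he, h1, h2⟩⟩ := hadj
    · exact ⟨e, he, ⟨_, h1, hd1⟩, _, h2, hd2⟩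
    · exact ⟨e, he, ⟨_, h2, hd1⟩, _, h1, hd2⟩
  have hsum := sum_countP_mem W E
  simp only [h3r, Finset.sum_const, smul_eq_mul] at hsum
  obtain ⟨E', rfl⟩ := Multiset.exists_cons_of_mem he
  have hsub : ((e ::ₘ E').toFinset.filter (· ⊆ W)).card ≤
      Multiset.card (E'.filter (· ⊆ W)) := by
    refine le_trans (Finset.card_le_card ?_) (Multiset.toFinset_card_le _)
    intro g hg
    simp only [Finset.mem_filter, Multiset.mem_toFinset, Multiset.mem_cons,
      Multiset.mem_filter] at hg ⊢
    obtain ⟨rfl | h1, h2⟩ := hg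
    · exact absurd (h2 hbe) hbW
    · exact ⟨h1, h2⟩
  have hlow : ∀ M : Multiset (Finset V), (∀ g ∈ M, g.card = 3) →
      3 * Multiset.card (M.filter (· ⊆ W)) ≤ (M.map fun g => (W ∩ g).card).sum := by
    intro M
    induction M using Multiset.induction_on with
    | empty => simp
    | cons g M ih =>
      intro hM
      have h1 := ih fun x hx => hM x (Multiset.mem_cons_of_mem hx)
      have h2 := hM g (Multiset.mem_cons_self _ _)
      rw [Multiset.map_cons, Multiset.sum_cons]
      by_cases hg : g ⊆ W
      · rw [Multiset.filter_cons_of_pos (p := (· ⊆ W)) _ hg, Multiset.card_cons, Finset.inter_eq_right.2 hg]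
        omega
      · rw [Multiset.filter_cons_of_neg (p := (· ⊆ W)) _ hg]
        omega
  have h1 := hlow E' fun g hg => h3u g (Multiset.mem_cons_of_mem hg)
  have h2 : 0 < (W ∩ e).card := Finset.card_pos.2 ⟨a, Finset.mem_inter.2 ⟨haW, hae⟩⟩
  rw [Multiset.map_cons, Multiset.sum_cons] at hsum
  omega

theorem card_le_three {V : Type*} [Fintype V] [DecidableEq V] (E : Multiset (Finset V))
    (e : Finset V) (he : e ∈ E) (hc : e.card = 3) (F : Multiset (Finset V))
    (hF : ∀ T ∈ F, IsTransversal E T) : Multiset.card F ≤ 3 * maxAppear F := by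
  have h1 : Multiset.card F ≤ (F.map fun T => (e ∩ T).card).sum := by
    have := Multiset.card_nsmul_le_sum (s := F.map fun T => (e ∩ T).card) (a := 1) (by
      intro x hx
      obtain ⟨T, hT, rfl⟩ := Multiset.mem_map.1 hx
      obtain ⟨v, hv, hvT⟩ := hF T hT e he
      exact Finset.card_pos.2 ⟨v, Finset.mem_inter.2 ⟨hv, hvT⟩⟩)
    simpa using this
  rw [← sum_countP_mem] at h1
  refine h1.trans ?_
  rw [← hc, ← smul_eq_mul]
  exact Finset.sum_le_card_nsmul _ _ _ fun v _ =>
    Finset.le_sup (f := fun v : V => appearCount F v) (Finset.mem_univ v)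

theorem stmt14 {V : Type*} [Fintype V] [DecidableEq V] (E : Multiset (Finset V))
    (h3u : ∀ e ∈ E, e.card = 3)
    (h3r : ∀ v : V, Multiset.countP (fun e => v ∈ e) E = 3)
    (hconn : (SimpleGraph.fromRel fun u v : V => ∃ e ∈ E, u ∈ e ∧ v ∈ e).Connected) :
    2 * (Fintype.card V : ℝ) / ((Fintype.card V : ℝ) + 1) ≤ FDT E := by
  obtain ⟨v₀⟩ := hconn.nonempty
  obtain ⟨e₀, he₀, -⟩ : ∃ e ∈ E, v₀ ∈ e := by
    rw [← Multiset.countP_pos, h3r]; norm_num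
  have hcol : ∀ v : V, ∃ T : Finset V, ∀ e ∈ E, v ∉ e →
      (∃ w ∈ e, w ∈ T) ∧ ∃ w ∈ e, w ∉ T := by
    intro v
    obtain ⟨T, hT⟩ := two_color E.toFinset _ (Finset.univ.erase v) le_rfl
      (fun W hW hne => edges_lt E h3u h3r hconn W hne v
        (fun hv => Finset.notMem_erase _ _ (hW hv)))
    refine ⟨T, fun e he hve => hT e (Multiset.mem_toFinset.2 he) ?_ ?_⟩
    · intro w hw
      exact Finset.mem_erase.2 ⟨fun h => hve (h ▸ hw), Finset.mem_univ _⟩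
    · exact Finset.card_pos.1 (by rw [h3u e he]; norm_num)
  choose T hT using hcol
  let F : Multiset (Finset V) := (Finset.univ.val.map fun v => insert v (T v)) +
    (Finset.univ.val.map fun v => insert v (T v)ᶜ)
  have hcard : Multiset.card F = 2 * Fintype.card V := by
    simp [F, two_mul]
  have hn : 0 < Fintype.card V := Fintype.card_pos_iff.2 ⟨v₀⟩
  have hF : ∀ S ∈ F, IsTransversal E S := by
    intro S hS e he
    rcases Multiset.mem_add.1 hS with hS | hS <;>
    · obtain ⟨v, -, rfl⟩ := Multiset.mem_map.1 hS
      by_cases hve : v ∈ e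
      · exact ⟨v, hve, Finset.mem_insert_self _ _⟩
      · obtain ⟨⟨a, ha, haT⟩, b, hb, hbT⟩ := hT v e he hve
        first
        | exact ⟨a, ha, Finset.mem_insert_of_mem haT⟩
        | exact ⟨b, hb, Finset.mem_insert_of_mem (Finset.mem_compl.2 hbT)⟩
  have hmax : maxAppear F ≤ Fintype.card V + 1 := by
    refine Finset.sup_le fun u _ => ?_
    have h1 : appearCount F u = (Finset.univ.filter fun v => u ∈ insert v (T v)).card +
        (Finset.univ.filter fun v => u ∈ insert v (T v)ᶜ).card := by
      simp only [appearCount, F, Multiset.countP_add, Multiset.countP_map]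
      rfl
    rw [h1, Finset.card_filter, Finset.card_filter, ← Finset.sum_add_distrib]
    have h2 : ∑ v : V, (1 + if u = v then 1 else 0) = Fintype.card V + 1 := by
      simp [Finset.sum_add_distrib]
    rw [← h2]
    refine Finset.sum_le_sum fun v _ => ?_
    by_cases huv : u = v <;> by_cases hu : u ∈ T v <;> simp_all
  have h3 := card_le_three E e₀ he₀ (h3u e₀ he₀) F hF
  have hbdd : BddAbove { r : ℝ | ∃ F : Multiset (Finset V), F ≠ 0 ∧
      (∀ T ∈ F, IsTransversal E T) ∧
      r = (Multiset.card F : ℝ) / (maxAppear F : ℝ) } := by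
    refine ⟨3, ?_⟩
    rintro r ⟨G, -, hG, rfl⟩
    refine div_le_of_le_mul₀ (by positivity) (by norm_num) ?_
    exact_mod_cast card_le_three E e₀ he₀ (h3u e₀ he₀) G hG
  refine le_trans ?_ (le_csSup hbdd ⟨F, ?_, hF, rfl⟩)
  · have hpos : 0 < maxAppear F := by omega
    rw [hcard]
    push_cast
    refine div_le_div_of_nonneg_left (by positivity) (by exact_mod_cast hpos) ?_
    exact_mod_cast hmax
  · intro h0
    rw [h0] at hcard
    simp at hcard
    omega
end

section
/- For every even integer k ≥ 2 there exists a connected graph G of order 6k with minimum degree 2 and maximum degree 3 (so in particular G is K_{1,4}-free, containing no induced K_{1,4}) such that FTD(G) = 3/2. -/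
/-- Adjacency: a path `0,…,n-1` with the extra edges `{0,5}` and `{n-3,n-1}`. -/
def gAdj (n : ℕ) (i j : ℕ) : Prop :=
  i + 1 = j ∨ j + 1 = i ∨ (i = 0 ∧ j = 5) ∨ (j = 0 ∧ i = 5) ∨
    (i + 3 = n ∧ j + 1 = n) ∨ (j + 3 = n ∧ i + 1 = n)

/-- The graph used in the construction. -/
def gGraph (n : ℕ) : SimpleGraph (Fin n) where
  Adj i j := gAdj n i.val j.val
  symm := ⟨fun i j h => by unfold gAdj at *; omega⟩
  loopless := ⟨fun i h => by unfold gAdj at *; omega⟩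

instance (n : ℕ) : DecidableRel (gGraph n).Adj := fun i j => by
  show Decidable (gAdj n i.val j.val)
  unfold gAdj; infer_instance

theorem gGraph_connected (n : ℕ) (hn : 12 ≤ n) : (gGraph n).Connected := by
  have h0 : ∀ m (hm : m < n), (gGraph n).Reachable ⟨0, by omega⟩ ⟨m, hm⟩ := by
    intro m
    induction m with
    | zero => intro hm; exact SimpleGraph.Reachable.refl _
    | succ m ih =>
      intro hm
      refine (ih (by omega)).trans (SimpleGraph.Adj.reachable ?_)
      exact Or.inl rfl
  have : Nonempty (Fin n) := ⟨⟨0, by omega⟩⟩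
  exact SimpleGraph.Connected.mk fun u v => (h0 u.1 u.2).symm.trans (h0 v.1 v.2)

theorem two_le_deg (n : ℕ) (v : Fin n) (a b : ℕ) (ha' : a < n) (hb' : b < n) (hab : a ≠ b)
    (ha : gAdj n v.val a) (hb : gAdj n v.val b) : 2 ≤ (gGraph n).degree v := by
  have hab2 : (⟨a, ha'⟩ : Fin n) ≠ ⟨b, hb'⟩ := by simpa using hab
  rw [← Finset.card_pair hab2, ← SimpleGraph.card_neighborFinset_eq_degree]
  apply Finset.card_le_card
  intro x hx
  simp only [Finset.mem_insert, Finset.mem_singleton] at hx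
  rw [SimpleGraph.mem_neighborFinset]
  rcases hx with rfl | rfl <;> assumption

theorem deg_ge_two (n : ℕ) (hn : 12 ≤ n) (v : Fin n) : 2 ≤ (gGraph n).degree v := by
  have hv := v.2
  by_cases h0 : v.val = 0
  · apply two_le_deg n v 1 5 <;> (try unfold gAdj) <;> omega
  by_cases h1 : v.val + 1 = n
  · apply two_le_deg n v (n - 2) (n - 3) <;> (try unfold gAdj) <;> omega
  · apply two_le_deg n v (v.val - 1) (v.val + 1) <;> (try unfold gAdj) <;> omega

theorem deg_le_card (n : ℕ) (v : Fin n) (s : Finset ℕ)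
    (h : ∀ u : Fin n, gAdj n v.val u.val → u.val ∈ s) : (gGraph n).degree v ≤ s.card := by
  rw [← SimpleGraph.card_neighborFinset_eq_degree, ← Finset.card_map Fin.valEmbedding]
  apply Finset.card_le_card
  intro x hx
  simp only [Finset.mem_map, SimpleGraph.mem_neighborFinset] at hx
  obtain ⟨u, hu, rfl⟩ := hx
  exact h u hu

theorem deg_le_three (n : ℕ) (hn : 12 ≤ n) (v : Fin n) : (gGraph n).degree v ≤ 3 := by
  refine (deg_le_card n v {v.val - 1, v.val + 1, if v.val = 0 then 5 else if v.val = 5 then 0 else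
    if v.val + 1 = n then n - 3 else n - 1} ?_).trans Finset.card_le_three
  intro u hu
  simp only [gAdj, Finset.mem_insert, Finset.mem_singleton] at *
  split_ifs <;> omega

theorem deg_zero (n : ℕ) (hn : 12 ≤ n) : (gGraph n).degree ⟨0, by omega⟩ ≤ 2 := by
  refine (deg_le_card n _ {1, 5} ?_).trans Finset.card_le_two
  intro u hu
  simp only [gAdj, Finset.mem_insert, Finset.mem_singleton] at *
  omega

theorem deg_five (n : ℕ) (hn : 12 ≤ n) : 3 ≤ (gGraph n).degree ⟨5, by omega⟩ := by
  have h : ({⟨0, by omega⟩, ⟨4, by omega⟩, ⟨6, by omega⟩} : Finset (Fin n)).card = 3 := by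
    rw [Finset.card_eq_three]
    exact ⟨_, _, _, by simp, by simp, by simp, rfl⟩
  rw [← h, ← SimpleGraph.card_neighborFinset_eq_degree]
  apply Finset.card_le_card
  intro x hx
  simp only [Finset.mem_insert, Finset.mem_singleton] at hx
  rw [SimpleGraph.mem_neighborFinset]
  rcases hx with rfl | rfl | rfl <;> simp [gGraph, gAdj]

theorem count_bound {V : Type*} [DecidableEq V] (a b c : V) (F : Multiset (Finset V))
    (h : ∀ S ∈ F, (a ∈ S ∨ b ∈ S) ∧ (b ∈ S ∨ c ∈ S) ∧ (a ∈ S ∨ c ∈ S)) :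
    2 * Multiset.card F ≤ appearCount F a + appearCount F b + appearCount F c := by
  unfold appearCount
  induction F using Multiset.induction_on with
  | empty => simp
  | cons S F ih =>
    have h1 := ih fun T hT => h T (Multiset.mem_cons_of_mem hT)
    have h2 := h S (Multiset.mem_cons_self S F)
    simp only [Multiset.countP_cons, Multiset.card_cons]
    split_ifs <;> first | omega | (exfalso; tauto)

theorem appear_le {V : Type*} [Fintype V] [DecidableEq V] (F : Multiset (Finset V)) (v : V) :
    appearCount F v ≤ maxAppear F :=
  Finset.le_sup (f := fun v : V => appearCount F v) (Finset.mem_univ v)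

theorem ftd_upper (n : ℕ) (hn : 12 ≤ n) (F : Multiset (Finset (Fin n)))
    (hF : ∀ S ∈ F, IsTotalDomSet (gGraph n) S) :
    (Multiset.card F : ℝ) / (maxAppear F : ℝ) ≤ 3 / 2 := by
  have key : ∀ (S : Finset (Fin n)), IsTotalDomSet (gGraph n) S → ∀ (m p q : ℕ) (hm : m < n)
      (hp : p < n) (hq : q < n), (∀ u, u < n → gAdj n m u → u = p ∨ u = q) →
      (⟨p, hp⟩ ∈ S ∨ ⟨q, hq⟩ ∈ S) := by
    intro S hS m p q hm hp hq h
    obtain ⟨⟨u, hu⟩, huS, hadj⟩ := hS ⟨m, hm⟩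
    rcases h u hu hadj with rfl | rfl
    · exact Or.inl huS
    · exact Or.inr huS
  have h := count_bound (⟨1, by omega⟩ : Fin n) ⟨3, by omega⟩ ⟨5, by omega⟩ F (by
    intro S hS
    have hS' := hF S hS
    refine ⟨key S hS' 2 1 3 (by omega) _ _ ?_, key S hS' 4 3 5 (by omega) _ _ ?_,
      key S hS' 0 1 5 (by omega) _ _ ?_⟩ <;>
    · intro u hu h
      unfold gAdj at h
      omega)
  have h1 := appear_le F (⟨1, by omega⟩ : Fin n)
  have h3 := appear_le F (⟨3, by omega⟩ : Fin n)
  have h5 := appear_le F (⟨5, by omega⟩ : Fin n)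
  have h6 : 2 * Multiset.card F ≤ 3 * maxAppear F := by omega
  have h7 : (2 : ℝ) * Multiset.card F ≤ 3 * maxAppear F := by exact_mod_cast h6
  apply div_le_of_le_mul₀ <;> first | positivity | linarith

/-- The `c`-th total dominating set. -/
def domSet (n c : ℕ) : Finset (Fin n) := Finset.univ.filter fun v => (v.val / 2) % 3 ≠ c

theorem domSet_isTotalDomSet (k : ℕ) (hk : 2 ≤ k) (c : ℕ) :
    IsTotalDomSet (gGraph (6 * k)) (domSet (6 * k) c) := by
  have key : ∀ (m p q : ℕ) (hm : m < 6 * k) (hp : p < 6 * k) (hq : q < 6 * k),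
      gAdj (6 * k) m p → gAdj (6 * k) m q → (p / 2) % 3 ≠ (q / 2) % 3 →
      ∃ u ∈ domSet (6 * k) c, (gGraph (6 * k)).Adj ⟨m, hm⟩ u := by
    intro m p q hm hp hq h1 h2 h3
    by_cases h : (p / 2) % 3 = c
    · exact ⟨⟨q, hq⟩, by simp only [domSet, Finset.mem_filter, Finset.mem_univ, true_and]; omega, h2⟩
    · exact ⟨⟨p, hp⟩, by simp only [domSet, Finset.mem_filter, Finset.mem_univ, true_and]; omega, h1⟩
  rintro ⟨v, hv⟩
  by_cases h0 : v = 0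
  · apply key v 1 5 <;> (try unfold gAdj) <;> omega
  by_cases h1 : v + 1 = 6 * k
  · apply key v (6 * k - 2) (6 * k - 3) <;> (try unfold gAdj) <;> omega
  · apply key v (v - 1) (v + 1) <;> (try unfold gAdj) <;> omega

theorem ftd_eq (k : ℕ) (hk : 2 ≤ k) : FTD (gGraph (6 * k)) = 3 / 2 := by
  apply IsGreatest.csSup_eq
  constructor
  · refine ⟨{domSet (6 * k) 0, domSet (6 * k) 1, domSet (6 * k) 2}, by simp, ?_, ?_⟩
    · intro S hS
      simp only [Multiset.insert_eq_cons, Multiset.mem_cons, Multiset.mem_singleton] at hS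
      rcases hS with rfl | rfl | rfl <;> exact domSet_isTotalDomSet k hk _
    · have h : maxAppear ({domSet (6 * k) 0, domSet (6 * k) 1, domSet (6 * k) 2} :
          Multiset (Finset (Fin (6 * k)))) = 2 := by
        have h1 : ∀ v, appearCount ({domSet (6 * k) 0, domSet (6 * k) 1, domSet (6 * k) 2} :
            Multiset (Finset (Fin (6 * k)))) v = 2 := by
          intro v
          unfold appearCount
          rw [Multiset.insert_eq_cons, Multiset.insert_eq_cons, ← Multiset.cons_zero]
          simp only [Multiset.countP_cons, Multiset.countP_zero, domSet, Finset.mem_filter,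
            Finset.mem_univ, true_and]
          split_ifs <;> omega
        unfold maxAppear
        simp only [h1]
        exact Finset.sup_const ⟨⟨0, by omega⟩, Finset.mem_univ _⟩ 2
      rw [h]
      simp
  · rintro r ⟨F, -, hF, rfl⟩
    exact ftd_upper _ (by omega) F hF

theorem stmt18 (k : ℕ) (hk : 2 ≤ k) (hke : Even k) :
    ∃ (G : SimpleGraph (Fin (6 * k))) (_ : DecidableRel G.Adj),
      G.Connected ∧ G.minDegree = 2 ∧ G.maxDegree = 3 ∧ FTD G = 3 / 2 := by
  have hn : 12 ≤ 6 * k := by omega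
  have : Nonempty (Fin (6 * k)) := ⟨⟨0, by omega⟩⟩
  refine ⟨gGraph (6 * k), inferInstance, gGraph_connected _ hn, ?_, ?_, ftd_eq k hk⟩
  · apply le_antisymm
    · exact (SimpleGraph.minDegree_le_degree _ _).trans (deg_zero _ hn)
    · exact SimpleGraph.le_minDegree_of_forall_le_degree _ _ (deg_ge_two _ hn)
  · apply le_antisymm
    · exact SimpleGraph.maxDegree_le_of_forall_degree_le _ _ (deg_le_three _ hn)
    · exact (deg_five _ hn).trans (SimpleGraph.degree_le_maxDegree _ _)
end

section
/- Let G be a graph of order n ≥ 4 with minimum degree at least 3 in which every edge lies in at least two triangles (that is, every two adjacent vertices have at least two common neighbors). Then FTD(G) ≤ d̄(G) − 1, where d̄(G) = 2|E(G)|/n is the average degree of G. -/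
/-- Truncated excess of domination of `A`. -/
def excessSum {V : Type*} [Fintype V] [DecidableEq V] (G : SimpleGraph V)
    [DecidableRel G.Adj] (A : Finset V) : ℕ :=
  ∑ u : V, ((G.neighborFinset u ∩ A).card - 1)

lemma excess_step {V : Type*} [Fintype V] [DecidableEq V] (G : SimpleGraph V)
    [DecidableRel G.Adj]
    (htri : ∀ u v : V, G.Adj u v → 2 ≤ (G.neighborFinset u ∩ G.neighborFinset v).card)
    (A : Finset V) (x y : V) (hx : x ∉ A) (hxy : G.Adj x y) :
    excessSum G A + 2 ≤ excessSum G (insert x (insert y A)) := by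
  have hc := htri x y hxy
  have h1 : (G.neighborFinset x ∩ G.neighborFinset y).card
      = ∑ u : V, if u ∈ G.neighborFinset x ∩ G.neighborFinset y then 1 else 0 := by
    rw [← Finset.card_filter, Finset.filter_mem_eq_inter, Finset.univ_inter]
  have h2 : excessSum G A + (G.neighborFinset x ∩ G.neighborFinset y).card
      ≤ excessSum G (insert x (insert y A)) := by
    rw [h1, excessSum, excessSum, ← Finset.sum_add_distrib]
    apply Finset.sum_le_sum
    intro u _
    have hmono : (G.neighborFinset u ∩ A).card
        ≤ (G.neighborFinset u ∩ insert x (insert y A)).card := by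
      apply Finset.card_le_card
      intro z hz
      simp only [Finset.mem_inter, Finset.mem_insert] at hz ⊢
      tauto
    split_ifs with hu
    · simp only [Finset.mem_inter, SimpleGraph.mem_neighborFinset] at hu
      have hyx : y ≠ x := hxy.ne'
      have hux : x ∈ G.neighborFinset u := by simpa using hu.1.symm
      have huy : y ∈ G.neighborFinset u := by simpa using hu.2.symm
      have e1 : (G.neighborFinset u ∩ insert x (insert y A)).card
          = (G.neighborFinset u ∩ insert y A).card + 1 := by
        rw [Finset.inter_insert_of_mem hux, Finset.card_insert_of_notMem]
        simp [hx, hyx.symm]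
      by_cases hy : y ∈ A
      · rw [e1, Finset.insert_eq_of_mem hy]
        have : 0 < (G.neighborFinset u ∩ A).card :=
          Finset.card_pos.2 ⟨y, Finset.mem_inter.2 ⟨huy, hy⟩⟩
        omega
      · rw [e1, Finset.inter_insert_of_mem huy, Finset.card_insert_of_notMem (by simp [hy])]
        omega
    · omega
  omega

lemma excess_ge {V : Type*} [Fintype V] [DecidableEq V] (G : SimpleGraph V)
    [DecidableRel G.Adj]
    (htri : ∀ u v : V, G.Adj u v → 2 ≤ (G.neighborFinset u ∩ G.neighborFinset v).card)
    (S : Finset V) (hS : IsTotalDomSet G S) : S.card ≤ excessSum G S := by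
  have hne : (S.powerset.filter fun A => A.card ≤ excessSum G A).Nonempty :=
    ⟨∅, by simp⟩
  obtain ⟨A, hA, hmax⟩ := Finset.exists_max_image _ Finset.card hne
  simp only [Finset.mem_filter, Finset.mem_powerset] at hA hmax
  by_cases hAS : A = S
  · exact hAS ▸ hA.2
  exfalso
  obtain ⟨x, hxS, hxA⟩ := Finset.exists_of_ssubset (hA.1.ssubset_of_ne hAS)
  obtain ⟨y, hyS, hxy⟩ := hS x
  have hstep := excess_step G htri A x y hxA hxy
  have hle1 := Finset.card_insert_le x (insert y A)
  have hle2 := Finset.card_insert_le y A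
  have hm := hmax (insert x (insert y A))
    ⟨Finset.insert_subset hxS (Finset.insert_subset hyS hA.1), by omega⟩
  have hlt : A.card < (insert x (insert y A)).card := by
    apply Finset.card_lt_card
    rw [Finset.ssubset_iff_of_subset]
    · exact ⟨x, by simp, hxA⟩
    · intro z hz
      simp [hz]
  omega

lemma weight_ge {V : Type*} [Fintype V] [DecidableEq V] (G : SimpleGraph V)
    [DecidableRel G.Adj]
    (htri : ∀ u v : V, G.Adj u v → 2 ≤ (G.neighborFinset u ∩ G.neighborFinset v).card)
    (S : Finset V) (hS : IsTotalDomSet G S) :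
    (Fintype.card V : ℝ) ≤ ∑ v ∈ S, ((G.degree v : ℝ) - 1) := by
  have h := excess_ge G htri S hS
  have h1 : excessSum G S + Fintype.card V = ∑ u : V, (G.neighborFinset u ∩ S).card := by
    rw [excessSum, ← Finset.card_univ, Finset.card_eq_sum_ones, ← Finset.sum_add_distrib]
    apply Finset.sum_congr rfl
    intro u _
    obtain ⟨w, hw, huw⟩ := hS u
    have : 0 < (G.neighborFinset u ∩ S).card :=
      Finset.card_pos.2 ⟨w, by simp [hw, huw]⟩
    omega
  have h2 : ∑ u : V, (G.neighborFinset u ∩ S).card = ∑ v ∈ S, G.degree v := by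
    have e : ∀ u, (G.neighborFinset u ∩ S).card = ∑ v ∈ S, if G.Adj v u then 1 else 0 := by
      intro u
      rw [← Finset.card_filter]
      congr 1
      ext z
      simp [and_comm, G.adj_comm]
    simp_rw [e]
    rw [Finset.sum_comm]
    apply Finset.sum_congr rfl
    intro v _
    rw [← Finset.card_filter, ← SimpleGraph.card_neighborFinset_eq_degree]
    congr 1
    ext z
    simp
  have h3 : Fintype.card V + S.card ≤ ∑ v ∈ S, G.degree v := by omega
  have h4 : (Fintype.card V : ℝ) + S.card ≤ ∑ v ∈ S, (G.degree v : ℝ) := by exact_mod_cast h3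
  rw [Finset.sum_sub_distrib]
  simp only [Finset.sum_const, nsmul_eq_mul, mul_one]
  linarith

lemma family_ge {V : Type*} [Fintype V] [DecidableEq V] (w : V → ℝ) (c : ℝ)
    (F : Multiset (Finset V)) (hF : ∀ S ∈ F, c ≤ ∑ v ∈ S, w v) :
    (Multiset.card F : ℝ) * c ≤ ∑ v : V, w v * (appearCount F v : ℝ) := by
  induction F using Multiset.induction_on with
  | empty => simp [appearCount]
  | cons S F ih =>
    have h1 := ih fun T hT => hF T (Multiset.mem_cons_of_mem hT)
    have h2 := hF S (Multiset.mem_cons_self S F)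
    have h3 : ∑ v : V, w v * (appearCount (S ::ₘ F) v : ℝ)
        = ∑ v : V, w v * (appearCount F v : ℝ) + ∑ v ∈ S, w v := by
      have : ∑ v ∈ S, w v = ∑ v : V, if v ∈ S then w v else 0 := by simp
      rw [this, ← Finset.sum_add_distrib]
      apply Finset.sum_congr rfl
      intro v _
      simp only [appearCount, Multiset.countP_cons]
      split_ifs <;> push_cast <;> ring
    rw [h3, Multiset.card_cons]
    push_cast
    linarith

theorem stmt19 {V : Type*} [Fintype V] [DecidableEq V] (G : SimpleGraph V)
    [DecidableRel G.Adj] (hn : 4 ≤ Fintype.card V) (hδ : 3 ≤ G.minDegree)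
    (htri : ∀ u v : V, G.Adj u v → 2 ≤ (G.neighborFinset u ∩ G.neighborFinset v).card) :
    FTD G ≤ 2 * (G.edgeFinset.card : ℝ) / (Fintype.card V : ℝ) - 1 := by
  have hnpos : (0 : ℝ) < Fintype.card V := by
    have : 0 < Fintype.card V := by omega
    exact_mod_cast this
  have hdeg : ∀ v, (3 : ℝ) ≤ G.degree v := fun v => by
    exact_mod_cast hδ.trans (G.minDegree_le_degree v)
  have hsum : ∑ v : V, ((G.degree v : ℝ) - 1)
      = 2 * (G.edgeFinset.card : ℝ) - Fintype.card V := by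
    rw [Finset.sum_sub_distrib]
    have := G.sum_degrees_eq_twice_card_edges
    have h' : ∑ v : V, (G.degree v : ℝ) = 2 * (G.edgeFinset.card : ℝ) := by exact_mod_cast this
    rw [h']
    simp
  have hnn : 0 ≤ ∑ v : V, ((G.degree v : ℝ) - 1) :=
    Finset.sum_nonneg fun v _ => by linarith [hdeg v]
  have hb : 2 * (G.edgeFinset.card : ℝ) / (Fintype.card V : ℝ) - 1
      = (∑ v : V, ((G.degree v : ℝ) - 1)) / Fintype.card V := by
    rw [hsum]
    field_simp
  rw [hb]
  have hbn : 0 ≤ (∑ v : V, ((G.degree v : ℝ) - 1)) / Fintype.card V := by positivity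
  apply Real.sSup_le _ hbn
  rintro r ⟨F, -, hF, rfl⟩
  rcases Nat.eq_zero_or_pos (maxAppear F) with h0 | h0
  · simpa [h0] using hbn
  have h0' : (0 : ℝ) < maxAppear F := by exact_mod_cast h0
  rw [div_le_div_iff₀ h0' hnpos]
  refine (family_ge (fun v => (G.degree v : ℝ) - 1) _ F
    fun S hS => weight_ge G htri S (hF S hS)).trans ?_
  rw [Finset.sum_mul]
  apply Finset.sum_le_sum
  intro v _
  have hv : appearCount F v ≤ maxAppear F :=
    Finset.le_sup (f := fun v : V => appearCount F v) (Finset.mem_univ v)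
  have hv' : (appearCount F v : ℝ) ≤ maxAppear F := by exact_mod_cast hv
  exact mul_le_mul_of_nonneg_left hv' (by linarith [hdeg v])
end
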